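/- arXiv:1806.09741 — 2 statements merged into one kernel-verified Lean document; each statement's English description precedes it below -/
import Mathlib

section
/- Let s ≥ 1 be a natural number, and for each i ∈ {1,…,s} let ξ_i ∈ ℂ be an (s!/i)-th root of unity, i.e. ξ_i^{s!/i} = 1. Suppose that for every tuple (d_1, …, d_s) of nonnegative integers satisfying d_1 + 2·d_2 + ⋯ + s·d_s = s! one has ξ_1^{d_1}·ξ_2^{d_2}⋯ξ_s^{d_s} = 1. Then ξ_j = ξ_1^j for all j ∈ {1,…,s}. -/
open scoped BigOperators

/-- Lemma 5.4: if `ξ i` is an `(s!/i)`-th root of unity for `i = 1, …, s` and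
`∏ ξ i ^ d i = 1` for every partition `∑ i * d i = s!` of `s!`, then
`ξ j = ξ 1 ^ j` for all `j ∈ {1, …, s}`. -/
theorem stmt4 (s : ℕ) (hs : 1 ≤ s) (ξ : ℕ → ℂ)
    (hroot : ∀ i ∈ Finset.Icc 1 s, ξ i ^ (Nat.factorial s / i) = 1)
    (hpart : ∀ d : ℕ → ℕ, (∑ i ∈ Finset.Icc 1 s, i * d i) = Nat.factorial s →
      (∏ i ∈ Finset.Icc 1 s, ξ i ^ d i) = 1) :
    ∀ j ∈ Finset.Icc 1 s, ξ j = ξ 1 ^ j := by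
  intro j hj
  have h1 : 1 ∈ Finset.Icc 1 s := by simp [hs]
  have hjs := Finset.mem_Icc.1 hj
  have hle : j ≤ Nat.factorial s := hjs.2.trans (Nat.self_le_factorial s)
  have hp := hpart (fun i => (if i = j then 1 else 0) +
    (if i = 1 then Nat.factorial s - j else 0)) (by
      simp only [mul_add, Finset.sum_add_distrib, mul_ite, mul_zero, Finset.sum_ite_eq',
        hj, h1, if_true]
      omega)
  simp only [pow_add, Finset.prod_mul_distrib, pow_ite, pow_zero, Finset.prod_ite_eq',
    hj, h1, if_true, pow_one] at hp
  have hr := hroot 1 h1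
  rw [Nat.div_one] at hr
  calc ξ j = ξ j * ξ 1 ^ (Nat.factorial s - j + j) := by
        rw [Nat.sub_add_cancel hle, hr, mul_one]
    _ = ξ 1 ^ j := by rw [pow_add, ← mul_assoc, hp, one_mul]
end

section
/- Let s ≥ 1 be a natural number and let k_1, …, k_s be integers such that for every tuple (d_1, …, d_s) of nonnegative integers satisfying d_1 + 2·d_2 + ⋯ + s·d_s = s! one has 1·k_1·d_1 + 2·k_2·d_2 + ⋯ + s·k_s·d_s ≡ 0 (mod s!). Then j·k_1 ≡ j·k_j (mod s!) for every j ∈ {1,…,s}. -/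
open scoped BigOperators

/-- Integer form of Lemma 5.4: if `∑ i * k i * d i ≡ 0 (mod s!)` for every
partition `∑ i * d i = s!` of `s!`, then `j * k 1 ≡ j * k j (mod s!)` for
every `j ∈ {1, …, s}`. -/
theorem stmt5 (s : ℕ) (hs : 1 ≤ s) (k : ℕ → ℤ)
    (h : ∀ d : ℕ → ℕ, (∑ i ∈ Finset.Icc 1 s, i * d i) = Nat.factorial s →
      (∑ i ∈ Finset.Icc 1 s, (i : ℤ) * k i * (d i : ℤ)) ≡ 0
        [ZMOD ((Nat.factorial s : ℤ))]) :
    ∀ j ∈ Finset.Icc 1 s, (j : ℤ) * k 1 ≡ (j : ℤ) * k j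
      [ZMOD ((Nat.factorial s : ℤ))] := by
  intro j hj
  have hjs := Finset.mem_Icc.mp hj
  have hle : j ≤ Nat.factorial s := hjs.2.trans (Nat.self_le_factorial s)
  have h1 : 1 ∈ Finset.Icc 1 s := Finset.mem_Icc.mpr ⟨le_refl 1, hs⟩
  have key := h (fun i => (if i = 1 then Nat.factorial s - j else 0) + (if i = j then 1 else 0)) (by
    simp only [mul_add, Finset.sum_add_distrib, mul_ite, mul_zero, Finset.sum_ite_eq', h1, hj,
      if_true]
    omega)
  simp only [Nat.cast_add, Nat.cast_ite, Nat.cast_zero, mul_add, Finset.sum_add_distrib, mul_ite,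
    mul_zero, Finset.sum_ite_eq', h1, hj, if_true, Nat.cast_sub hle, Nat.cast_one, one_mul,
    mul_one] at key
  obtain ⟨c, hc⟩ := (Int.modEq_zero_iff_dvd).mp key
  refine (Int.modEq_iff_dvd).mpr ⟨c - k 1, ?_⟩
  linear_combination hc
end
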